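/- arXiv:2605.21257 — 2 statements merged into one kernel-verified Lean document; each statement's English description precedes it below -/
import Mathlib

section
/- Let p_1, ..., p_M be Borel probability measures on ℝ, each with finite first moment, let w_1, ..., w_M ≥ 0 satisfy Σ_{m=1}^M w_m = 1, let β_1, ..., β_M ∈ (0,1), and set β = Σ_{m=1}^M w_m β_m. For each m, let v_m = sup{ζ ∈ ℝ : p_m([ζ, ∞)) ≥ 1 − β_m} be finite with p_m((−∞, v_m]) > 0, and suppose the mode-wise CVaR constraint holds: (1 / p_m((−∞, v_m])) ∫_{(−∞, v_m]} x dp_m(x) ≥ 0. Then the mixture measure p = Σ_{m=1}^M w_m p_m satisfies p([0, ∞)) ≥ 1 − β. -/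
open MeasureTheory

/-- A superlevel bound on the survival function `ζ ↦ μ (Ici ζ)` of a finite measure passes to
every point at or below the supremum of the superlevel set. -/
theorem le_measure_Ici_of_le_sSup (μ : Measure ℝ) [IsFiniteMeasure μ] {c : ENNReal} {a : ℝ}
    (hne : {ζ : ℝ | μ (Set.Ici ζ) ≥ c}.Nonempty)
    (ha : a ≤ sSup {ζ : ℝ | μ (Set.Ici ζ) ≥ c}) : c ≤ μ (Set.Ici a) := by
  have hlt : ∀ b < a, c ≤ μ (Set.Ici b) := fun b hb => by
    obtain ⟨ζ, hζ, hbζ⟩ := exists_lt_of_lt_csSup hne (hb.trans_le ha)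
    exact le_trans hζ (measure_mono (Set.Ici_subset_Ici.2 hbζ.le))
  obtain ⟨u, hu_mono, hu_lt, hu_tendsto⟩ := exists_seq_strictMono_tendsto a
  have hInter : ⋂ n, Set.Ici (u n) = Set.Ici a := by
    ext x
    simp only [Set.mem_iInter, Set.mem_Ici]
    exact ⟨fun h => le_of_tendsto' hu_tendsto h, fun h n => (hu_lt n).le.trans h⟩
  have hlim := tendsto_measure_iInter_atTop (μ := μ) (s := fun n => Set.Ici (u n))
    (fun n => measurableSet_Ici.nullMeasurableSet)
    (fun i j hij => Set.Ici_subset_Ici.2 (hu_mono.monotone hij)) ⟨0, measure_ne_top _ _⟩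
  rw [hInter] at hlim
  exact ge_of_tendsto' hlim fun n => hlt _ (hu_lt n)

/-- If the lower tail below `v` has positive mass and nonnegative first moment, then `0 ≤ v`. -/
theorem nonneg_of_setIntegral_Iic_nonneg {μ : Measure ℝ} [IsFiniteMeasure μ]
    (hint : Integrable (fun x : ℝ => x) μ) {v : ℝ} (hpos : 0 < μ (Set.Iic v))
    (h : 0 ≤ ∫ x in Set.Iic v, x ∂μ) : 0 ≤ v := by
  have hle : ∫ x in Set.Iic v, x ∂μ ≤ ∫ _ in Set.Iic v, v ∂μ :=
    setIntegral_mono_on hint.integrableOn (integrable_const v).integrableOn measurableSet_Iic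
      fun x hx => hx
  rw [setIntegral_const, smul_eq_mul] at hle
  exact nonneg_of_mul_nonneg_right (h.trans hle)
    (ENNReal.toReal_pos hpos.ne' (measure_ne_top _ _))

/-- Proposition 1 (mode-wise CVaR constraint): if each mode `p m` of a mixture
satisfies a nonnegative CVaR constraint at level `β m`, where
`v m = VaR_{β m}(p m)` is finite and `p m (Iic (v m)) > 0`, then the mixture
`∑ m, w m • p m` satisfies the chance constraint at level `β = ∑ m, w m * β m`. -/
theorem mixture_chance_of_modewise_cvar
    (M : ℕ) (hM : 1 ≤ M)
    (p : Fin M → Measure ℝ) (hp : ∀ m, IsProbabilityMeasure (p m))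
    (hmom : ∀ m, Integrable (fun x : ℝ => x) (p m))
    (w : Fin M → ℝ) (hw : ∀ m, 0 ≤ w m) (hw1 : ∑ m, w m = 1)
    (β : Fin M → ℝ) (hβ : ∀ m, β m ∈ Set.Ioo (0 : ℝ) 1)
    (v : Fin M → ℝ)
    (hv : ∀ m, v m = sSup {ζ : ℝ | p m (Set.Ici ζ) ≥ ENNReal.ofReal (1 - β m)})
    (hne : ∀ m, ({ζ : ℝ | p m (Set.Ici ζ) ≥ ENNReal.ofReal (1 - β m)}).Nonempty)
    (hbdd : ∀ m, BddAbove {ζ : ℝ | p m (Set.Ici ζ) ≥ ENNReal.ofReal (1 - β m)})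
    (hpos : ∀ m, 0 < p m (Set.Iic (v m)))
    (hcvar : ∀ m,
      0 ≤ (1 / (p m (Set.Iic (v m))).toReal) * ∫ x in Set.Iic (v m), x ∂(p m)) :
    (∑ m, ENNReal.ofReal (w m) • p m) (Set.Ici (0 : ℝ))
      ≥ ENNReal.ofReal (1 - ∑ m, w m * β m) := by
  have hmode : ∀ m, ENNReal.ofReal (1 - β m) ≤ p m (Set.Ici 0) := fun m => by
    have := hp m
    have hinv : 0 < 1 / (p m (Set.Iic (v m))).toReal :=
      one_div_pos.2 (ENNReal.toReal_pos (hpos m).ne' (measure_ne_top _ _))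
    have hv0 : 0 ≤ v m := nonneg_of_setIntegral_Iic_nonneg (hmom m) (hpos m)
      (nonneg_of_mul_nonneg_right (hcvar m) hinv)
    exact le_measure_Ici_of_le_sSup (p m) (hne m) (hv m ▸ hv0)
  have hbudget : 1 - ∑ m, w m * β m = ∑ m, w m * (1 - β m) := by
    simp only [mul_sub, mul_one, Finset.sum_sub_distrib, hw1]
  rw [ge_iff_le, hbudget, ENNReal.ofReal_sum_of_nonneg fun m _ =>
    mul_nonneg (hw m) (sub_nonneg.2 (hβ m).2.le), Measure.finsetSum_apply]
  refine Finset.sum_le_sum fun m _ => ?_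
  rw [ENNReal.ofReal_mul (hw m), Measure.smul_apply, smul_eq_mul]
  gcongr
  exact hmode m
end

section
/- Let α : ℝ → ℝ be strictly increasing with α(0) = 0 (an extended class-K function), let t₀ < t₁ be reals, and let h : ℝ → ℝ be differentiable on [t₀, t₁] with h(t₀) ≥ 0 and h'(t) ≥ −α(h(t)) for all t ∈ [t₀, t₁]. Then h(t) ≥ 0 for all t ∈ [t₀, t₁]. -/
/-- Deterministic control-barrier-function invariance: if `α` is an extended
class-K function (strictly increasing with `α 0 = 0`), `h` is differentiable on
`[t₀, t₁]` with derivative `h'`, `h t₀ ≥ 0`, and the barrier condition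
`h' t ≥ -α (h t)` holds on `[t₀, t₁]`, then `h` stays nonnegative on `[t₀, t₁]`. -/
theorem cbf_invariance
    (α : ℝ → ℝ) (hα : StrictMono α) (hα0 : α 0 = 0)
    (t₀ t₁ : ℝ) (ht : t₀ < t₁)
    (h h' : ℝ → ℝ)
    (hderiv : ∀ t ∈ Set.Icc t₀ t₁, HasDerivAt h (h' t) t)
    (h0 : 0 ≤ h t₀)
    (hbarrier : ∀ t ∈ Set.Icc t₀ t₁, -α (h t) ≤ h' t) :
    ∀ t ∈ Set.Icc t₀ t₁, 0 ≤ h t := by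
  intro t htI
  refine le_of_forall_pos_le_add fun ε hε => ?_
  have hle : -h t ≤ ε :=
    image_le_of_deriv_right_lt_deriv_boundary (f := fun x => -h x) (f' := fun x => -h' x)
      (B := fun _ => ε) (B' := fun _ => 0) (a := t₀) (b := t₁)
      (fun x hx => (hderiv x hx).neg.continuousAt.continuousWithinAt)
      (fun x hx => (hderiv x (Set.Ico_subset_Icc_self hx)).neg.hasDerivWithinAt)
      (by linarith) (fun x => hasDerivAt_const x ε)
      (fun x hx hxε => by
        have hneg : α (h x) < 0 := by
          rw [← hα0]
          exact hα (by linarith)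
        linarith [hbarrier x (Set.Ico_subset_Icc_self hx)])
      htI
  linarith
end
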